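/- Let C, A₀, A₁,…,A_m ∈ Sym(n) with A₀ positive definite, b ∈ ℝ^m, b₀ ≥ 0, μ > 0. Define the extended operator 𝒜̃ : Sym(n) → ℝ^{m+1} by 𝒜̃(X)_i = ⟨A_i,X⟩ for i = 0,…,m, the extended right-hand side b̃ = (b₀, b), the residues r(U) = 𝒜(UUᵀ) − b and r̃(U) = 𝒜̃(UUᵀ) − b̃, and L̃_μ(U) = ⟨C, UUᵀ⟩ + μ‖r̃(U)‖₂². Then for every U ∈ ℝ^{n×k}: ‖r(U)‖₂ ≤ ‖𝒜‖‖U‖_F² + ‖b‖₂ and ‖r̃(U)‖₂ ≤ ‖𝒜̃‖‖U‖_F² + ‖b̃‖₂. Moreover, if U is an ε-FOSP of L̃_μ and b₀ > 0, then ‖U‖_F² ≤ max{ (ε/(2μ b₀ λ_max(A₀)))², (1/λ_min(A₀)²)(‖C‖₂/(2μ) + (3/2) b₀ λ_max(A₀)) + ‖b‖₂/(2 λ_min(A₀)) }. -/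

import Mathlib

open Matrix

attribute [local instance] Matrix.normedAddCommGroup Matrix.normedSpace

/-- Trace inner product `⟨A, B⟩ = Tr(Aᵀ B)` on square matrices. -/
noncomputable def mip {n : ℕ} (A B : Matrix (Fin n) (Fin n) ℝ) : ℝ := (Aᵀ * B).trace

/-- Frobenius inner product on rectangular matrices. -/
noncomputable def mipr {n k : ℕ} (A B : Matrix (Fin n) (Fin k) ℝ) : ℝ :=
  ∑ i, ∑ j, A i j * B i j

/-- Euclidean norm of a vector. -/
noncomputable def vnorm {k : ℕ} (z : Fin k → ℝ) : ℝ := Real.sqrt (∑ i, z i ^ 2)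

/-- Frobenius norm of a matrix. -/
noncomputable def fnorm {n k : ℕ} (A : Matrix (Fin n) (Fin k) ℝ) : ℝ :=
  Real.sqrt (∑ i, ∑ j, A i j ^ 2)

/-- Operator norm `‖𝒜‖ = max{‖𝒜(Y)‖₂ : Y ∈ Sym(n), ‖Y‖_F ≤ 1}` of `𝒜(X)ᵢ = ⟨Aᵢ, X⟩`. -/
noncomputable def opA {n m : ℕ} (A : Fin m → Matrix (Fin n) (Fin n) ℝ) : ℝ :=
  sSup {t | ∃ Y : Matrix (Fin n) (Fin n) ℝ, Y.IsSymm ∧ fnorm Y ≤ 1 ∧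
    t = vnorm (fun i => mip (A i) Y)}

/-- Largest eigenvalue of a symmetric matrix, via the Rayleigh quotient. -/
noncomputable def lamMax {n : ℕ} (A : Matrix (Fin n) (Fin n) ℝ) : ℝ :=
  sSup {t | ∃ x : Fin n → ℝ, vnorm x = 1 ∧ t = x ⬝ᵥ A.mulVec x}

/-- Smallest eigenvalue of a symmetric matrix, via the Rayleigh quotient. -/
noncomputable def lamMin {n : ℕ} (A : Matrix (Fin n) (Fin n) ℝ) : ℝ :=
  sInf {t | ∃ x : Fin n → ℝ, vnorm x = 1 ∧ t = x ⬝ᵥ A.mulVec x}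

/-- Spectral norm `‖C‖₂ = max_{‖x‖₂ = 1} ‖C x‖₂`. -/
noncomputable def specNorm {n : ℕ} (C : Matrix (Fin n) (Fin n) ℝ) : ℝ :=
  sSup {t | ∃ x : Fin n → ℝ, vnorm x = 1 ∧ t = vnorm (C.mulVec x)}

lemma vnorm_eq_norm {k : ℕ} (z : Fin k → ℝ) : vnorm z = ‖WithLp.toLp 2 z‖ := by
  simp [vnorm, EuclideanSpace.norm_eq]

lemma vnorm_nonneg {k : ℕ} (z : Fin k → ℝ) : 0 ≤ vnorm z := Real.sqrt_nonneg _

lemma vnorm_sq {k : ℕ} (z : Fin k → ℝ) : vnorm z ^ 2 = ∑ i, z i ^ 2 :=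
  Real.sq_sqrt (Finset.sum_nonneg fun _ _ => sq_nonneg _)

lemma vnorm_sub_le {k : ℕ} (y z : Fin k → ℝ) :
    vnorm (fun i => y i - z i) ≤ vnorm y + vnorm z := by
  simp only [vnorm_eq_norm]
  exact norm_sub_le (WithLp.toLp 2 y) (WithLp.toLp 2 z)

lemma vnorm_smul {k : ℕ} (c : ℝ) (z : Fin k → ℝ) : vnorm (c • z) = |c| * vnorm z := by
  simp only [vnorm_eq_norm, WithLp.toLp_smul, norm_smul, Real.norm_eq_abs]

lemma vnorm_eq_zero {k : ℕ} {z : Fin k → ℝ} (h : vnorm z = 0) : z = 0 := by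
  rw [vnorm_eq_norm, norm_eq_zero] at h
  simpa using h

lemma abs_dotProduct_le {k : ℕ} (y z : Fin k → ℝ) : |y ⬝ᵥ z| ≤ vnorm y * vnorm z := by
  apply abs_le_of_sq_le_sq _ (mul_nonneg (vnorm_nonneg _) (vnorm_nonneg _))
  rw [mul_pow, vnorm_sq, vnorm_sq]
  exact Finset.sum_mul_sq_le_sq_mul_sq _ _ _

lemma fnorm_nonneg {n k : ℕ} (Y : Matrix (Fin n) (Fin k) ℝ) : 0 ≤ fnorm Y := Real.sqrt_nonneg _

lemma fnorm_sq {n k : ℕ} (Y : Matrix (Fin n) (Fin k) ℝ) :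
    fnorm Y ^ 2 = ∑ i, ∑ j, Y i j ^ 2 :=
  Real.sq_sqrt (Finset.sum_nonneg fun _ _ => Finset.sum_nonneg fun _ _ => sq_nonneg _)

lemma fnorm_smul {n k : ℕ} (c : ℝ) (Y : Matrix (Fin n) (Fin k) ℝ) :
    fnorm (c • Y) = |c| * fnorm Y := by
  rw [← Real.sqrt_sq_eq_abs, fnorm, fnorm, ← Real.sqrt_mul (sq_nonneg c)]
  simp [Finset.mul_sum, mul_pow]

lemma sq_entry_le_fnorm_sq {n k : ℕ} (Y : Matrix (Fin n) (Fin k) ℝ) (i : Fin n) (j : Fin k) :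
    Y i j ^ 2 ≤ fnorm Y ^ 2 := by
  rw [fnorm_sq]
  calc Y i j ^ 2 ≤ ∑ j, Y i j ^ 2 :=
        Finset.single_le_sum (f := fun j => Y i j ^ 2) (fun _ _ => sq_nonneg _) (Finset.mem_univ j)
    _ ≤ _ := Finset.single_le_sum (f := fun i => ∑ j, Y i j ^ 2)
        (fun _ _ => Finset.sum_nonneg fun _ _ => sq_nonneg _) (Finset.mem_univ i)

lemma eq_zero_of_fnorm_eq_zero {n k : ℕ} {Y : Matrix (Fin n) (Fin k) ℝ} (h : fnorm Y = 0) :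
    Y = 0 := by
  ext i j
  have := sq_entry_le_fnorm_sq Y i j
  rw [h] at this
  rw [Matrix.zero_apply]
  exact pow_eq_zero_iff two_ne_zero |>.1 (le_antisymm (by simpa using this) (sq_nonneg _))

lemma abs_mipr_le {n k : ℕ} (Y Z : Matrix (Fin n) (Fin k) ℝ) :
    |mipr Y Z| ≤ fnorm Y * fnorm Z := by
  apply abs_le_of_sq_le_sq _ (mul_nonneg (fnorm_nonneg _) (fnorm_nonneg _))
  rw [mul_pow, fnorm_sq, fnorm_sq, mipr]
  simp only [← Fintype.sum_prod_type']
  exact Finset.sum_mul_sq_le_sq_mul_sq _ _ _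

lemma fnorm_mul_transpose_le {n k : ℕ} (U : Matrix (Fin n) (Fin k) ℝ) :
    fnorm (U * Uᵀ) ≤ fnorm U ^ 2 := by
  apply le_of_sq_le_sq _ (sq_nonneg _)
  rw [fnorm_sq, fnorm_sq, sq (∑ i, ∑ j, U i j ^ 2), Finset.sum_mul_sum]
  gcongr with i _ j _
  simp only [mul_apply, transpose_apply]
  exact Finset.sum_mul_sq_le_sq_mul_sq _ _ _

lemma mip_smul_right {n : ℕ} (c : ℝ) (B Y : Matrix (Fin n) (Fin n) ℝ) :
    mip B (c • Y) = c * mip B Y := by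
  simp [mip]

lemma mip_mul_transpose {n k : ℕ} (B : Matrix (Fin n) (Fin n) ℝ)
    (U : Matrix (Fin n) (Fin k) ℝ) :
    mip B (U * Uᵀ) = ∑ j, U.col j ⬝ᵥ B *ᵥ U.col j := by
  simp only [mip, trace, diag, mul_apply, transpose_apply, dotProduct, mulVec, col_apply,
    Finset.mul_sum]
  conv_rhs => rw [Finset.sum_comm]
  rw [Finset.sum_comm]
  refine Finset.sum_congr rfl fun p _ => ?_
  rw [Finset.sum_comm]
  refine Finset.sum_congr rfl fun q _ => Finset.sum_congr rfl fun j _ => ?_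
  ring

lemma fnorm_sq_eq_sum_col {n k : ℕ} (U : Matrix (Fin n) (Fin k) ℝ) :
    fnorm U ^ 2 = ∑ j, vnorm (U.col j) ^ 2 := by
  simp only [fnorm_sq, vnorm_sq, col_apply]
  exact Finset.sum_comm

lemma isCompact_setOf_vnorm_eq_one (n : ℕ) : IsCompact {x : Fin n → ℝ | vnorm x = 1} := by
  refine (isCompact_Icc (a := fun _ : Fin n => (-1 : ℝ)) (b := fun _ => 1)).of_isClosed_subset
    (isClosed_eq (by unfold vnorm; fun_prop) continuous_const) fun x hx => ?_
  have h : ∀ i, |x i| ≤ 1 := fun i => by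
    apply abs_le_of_sq_le_sq _ zero_le_one
    rw [← show vnorm x = 1 from hx, vnorm_sq]
    exact Finset.single_le_sum (f := fun i => x i ^ 2) (fun _ _ => sq_nonneg _) (Finset.mem_univ i)
  exact ⟨fun i => (abs_le.1 (h i)).1, fun i => (abs_le.1 (h i)).2⟩

lemma isCompact_setOf_eq_on_sphere {n : ℕ} {φ : (Fin n → ℝ) → ℝ} (hφ : Continuous φ) :
    IsCompact {t | ∃ x : Fin n → ℝ, vnorm x = 1 ∧ t = φ x} := by
  convert (isCompact_setOf_vnorm_eq_one n).image hφ using 1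
  ext t
  simp [eq_comm]

lemma isCompact_quadratic_values {n : ℕ} (B : Matrix (Fin n) (Fin n) ℝ) :
    IsCompact {t | ∃ x : Fin n → ℝ, vnorm x = 1 ∧ t = x ⬝ᵥ B *ᵥ x} :=
  isCompact_setOf_eq_on_sphere (by unfold mulVec dotProduct; fun_prop)

lemma exists_unit_smul {n : ℕ} (x : Fin n → ℝ) (hx : vnorm x ≠ 0) :
    ∃ y, vnorm y = 1 ∧ x = vnorm x • y := by
  refine ⟨(vnorm x)⁻¹ • x, ?_, (smul_inv_smul₀ hx x).symm⟩
  rw [vnorm_smul, abs_inv, abs_of_nonneg (vnorm_nonneg x), inv_mul_cancel₀ hx]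

lemma quadratic_smul {n : ℕ} (B : Matrix (Fin n) (Fin n) ℝ) (c : ℝ) (y : Fin n → ℝ) :
    (c • y) ⬝ᵥ B *ᵥ (c • y) = (y ⬝ᵥ B *ᵥ y) * c ^ 2 := by
  simp only [mulVec_smul, smul_dotProduct, dotProduct_smul, smul_eq_mul]
  ring

lemma quadratic_le_lamMax {n : ℕ} (B : Matrix (Fin n) (Fin n) ℝ) (x : Fin n → ℝ) :
    x ⬝ᵥ B *ᵥ x ≤ lamMax B * vnorm x ^ 2 := by
  by_cases hx : vnorm x = 0
  · rw [hx, vnorm_eq_zero hx]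
    simp
  obtain ⟨y, hy, hxy⟩ := exists_unit_smul x hx
  conv_lhs => rw [hxy, quadratic_smul]
  gcongr
  exact le_csSup (isCompact_quadratic_values B).bddAbove ⟨y, hy, rfl⟩

lemma lamMin_le_quadratic {n : ℕ} (B : Matrix (Fin n) (Fin n) ℝ) (x : Fin n → ℝ) :
    lamMin B * vnorm x ^ 2 ≤ x ⬝ᵥ B *ᵥ x := by
  by_cases hx : vnorm x = 0
  · rw [hx, vnorm_eq_zero hx]
    simp
  obtain ⟨y, hy, hxy⟩ := exists_unit_smul x hx
  conv_rhs => rw [hxy, quadratic_smul]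
  gcongr
  exact csInf_le (isCompact_quadratic_values B).bddBelow ⟨y, hy, rfl⟩

lemma abs_quadratic_le_specNorm {n : ℕ} (B : Matrix (Fin n) (Fin n) ℝ) (x : Fin n → ℝ) :
    |x ⬝ᵥ B *ᵥ x| ≤ specNorm B * vnorm x ^ 2 := by
  by_cases hx : vnorm x = 0
  · rw [hx, vnorm_eq_zero hx]
    simp
  obtain ⟨y, hy, hxy⟩ := exists_unit_smul x hx
  conv_lhs => rw [hxy, quadratic_smul, abs_mul, abs_of_nonneg (sq_nonneg (vnorm x))]
  gcongr
  refine (abs_dotProduct_le _ _).trans ?_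
  rw [hy, one_mul]
  exact le_csSup (isCompact_setOf_eq_on_sphere (φ := fun x => vnorm (B *ᵥ x))
    (by unfold vnorm mulVec dotProduct; fun_prop)).bddAbove ⟨y, hy, rfl⟩

lemma mip_mul_transpose_le_lamMax {n k : ℕ} (B : Matrix (Fin n) (Fin n) ℝ)
    (U : Matrix (Fin n) (Fin k) ℝ) : mip B (U * Uᵀ) ≤ lamMax B * fnorm U ^ 2 := by
  rw [mip_mul_transpose, fnorm_sq_eq_sum_col, Finset.mul_sum]
  exact Finset.sum_le_sum fun j _ => quadratic_le_lamMax B _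

lemma lamMin_le_mip_mul_transpose {n k : ℕ} (B : Matrix (Fin n) (Fin n) ℝ)
    (U : Matrix (Fin n) (Fin k) ℝ) : lamMin B * fnorm U ^ 2 ≤ mip B (U * Uᵀ) := by
  rw [mip_mul_transpose, fnorm_sq_eq_sum_col, Finset.mul_sum]
  exact Finset.sum_le_sum fun j _ => lamMin_le_quadratic B _

lemma abs_mip_mul_transpose_le_specNorm {n k : ℕ} (B : Matrix (Fin n) (Fin n) ℝ)
    (U : Matrix (Fin n) (Fin k) ℝ) : |mip B (U * Uᵀ)| ≤ specNorm B * fnorm U ^ 2 := by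
  rw [mip_mul_transpose, fnorm_sq_eq_sum_col, Finset.mul_sum]
  exact (Finset.abs_sum_le_sum_abs _ _).trans
    (Finset.sum_le_sum fun j _ => abs_quadratic_le_specNorm B _)

lemma specNorm_nonneg {n : ℕ} (B : Matrix (Fin n) (Fin n) ℝ) : 0 ≤ specNorm B :=
  Real.sSup_nonneg (by rintro _ ⟨x, -, rfl⟩; exact vnorm_nonneg _)

lemma exists_vnorm_eq_one {n : ℕ} (hn : 0 < n) : ∃ x : Fin n → ℝ, vnorm x = 1 :=
  ⟨Pi.single ⟨0, hn⟩ 1, by simp [vnorm, Pi.single_apply]⟩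

lemma lamMin_pos {n : ℕ} (hn : 0 < n) {B : Matrix (Fin n) (Fin n) ℝ} (hB : B.PosDef) :
    0 < lamMin B := by
  obtain ⟨x, hx⟩ := exists_vnorm_eq_one hn
  obtain ⟨y, hy, hmin⟩ := (isCompact_quadratic_values B).sInf_mem ⟨_, x, hx, rfl⟩
  have hy0 : y ≠ 0 := by rintro rfl; simp [vnorm] at hy
  rw [lamMin, hmin]
  simpa using hB.dotProduct_mulVec_pos hy0

lemma lamMax_pos {n : ℕ} (hn : 0 < n) {B : Matrix (Fin n) (Fin n) ℝ} (hB : B.PosDef) :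
    0 < lamMax B := by
  obtain ⟨x, hx⟩ := exists_vnorm_eq_one hn
  have h₁ := lamMin_le_quadratic B x
  have h₂ := quadratic_le_lamMax B x
  rw [hx] at h₁ h₂
  linarith [lamMin_pos hn hB]

lemma continuous_vnorm_mip {n m : ℕ} (A : Fin m → Matrix (Fin n) (Fin n) ℝ) :
    Continuous fun Y => vnorm (fun i => mip (A i) Y) := by
  unfold vnorm mip
  fun_prop

lemma bddAbove_opA {n m : ℕ} (A : Fin m → Matrix (Fin n) (Fin n) ℝ) :
    BddAbove {t | ∃ Y : Matrix (Fin n) (Fin n) ℝ, Y.IsSymm ∧ fnorm Y ≤ 1 ∧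
      t = vnorm (fun i => mip (A i) Y)} := by
  have : ProperSpace (Matrix (Fin n) (Fin n) ℝ) := FiniteDimensional.proper_real _
  refine ((isCompact_closedBall (0 : Matrix (Fin n) (Fin n) ℝ) 1).image
    (continuous_vnorm_mip A)).bddAbove.mono ?_
  rintro _ ⟨Y, -, hY, rfl⟩
  refine ⟨Y, ?_, rfl⟩
  rw [mem_closedBall_zero_iff, Matrix.norm_le_iff zero_le_one]
  intro i j
  rw [Real.norm_eq_abs]
  exact (abs_le_of_sq_le_sq (sq_entry_le_fnorm_sq Y i j) (fnorm_nonneg Y)).trans hY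

lemma opA_nonneg {n m : ℕ} (A : Fin m → Matrix (Fin n) (Fin n) ℝ) : 0 ≤ opA A :=
  Real.sSup_nonneg (by rintro _ ⟨Y, -, -, rfl⟩; exact vnorm_nonneg _)

lemma vnorm_mip_le_opA {n m : ℕ} (A : Fin m → Matrix (Fin n) (Fin n) ℝ)
    {Y : Matrix (Fin n) (Fin n) ℝ} (hY : Y.IsSymm) :
    vnorm (fun i => mip (A i) Y) ≤ opA A * fnorm Y := by
  by_cases h : fnorm Y = 0
  · simp [eq_zero_of_fnorm_eq_zero h, mip, vnorm, fnorm]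
  have hpos : 0 < fnorm Y := lt_of_le_of_ne (fnorm_nonneg Y) (Ne.symm h)
  rw [← div_le_iff₀ hpos]
  refine le_csSup (bddAbove_opA A) ⟨(fnorm Y)⁻¹ • Y, hY.smul _, ?_, ?_⟩
  · rw [fnorm_smul, abs_inv, abs_of_pos hpos, inv_mul_cancel₀ h]
  · simp only [mip_smul_right]
    change _ = vnorm ((fnorm Y)⁻¹ • fun i => mip (A i) Y)
    rw [vnorm_smul, abs_inv, abs_of_pos hpos, div_eq_inv_mul]

lemma vnorm_residue_le {n m k : ℕ} (A : Fin m → Matrix (Fin n) (Fin n) ℝ) (b : Fin m → ℝ)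
    (U : Matrix (Fin n) (Fin k) ℝ) :
    vnorm (fun i => mip (A i) (U * Uᵀ) - b i) ≤ opA A * fnorm U ^ 2 + vnorm b := by
  refine (vnorm_sub_le _ _).trans (add_le_add_left ?_ _)
  have hsymm : (U * Uᵀ).IsSymm := by simp [IsSymm]
  exact (vnorm_mip_le_opA A hsymm).trans
    (mul_le_mul_of_nonneg_left (fnorm_mul_transpose_le U) (opA_nonneg A))

lemma differentiable_mip_mul_transpose {n k : ℕ} (B : Matrix (Fin n) (Fin n) ℝ) :
    Differentiable ℝ fun W : Matrix (Fin n) (Fin k) ℝ => mip B (W * Wᵀ) := by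
  have h : ∀ i j, Differentiable ℝ fun W : Matrix (Fin n) (Fin k) ℝ => W i j := fun i j =>
    (LinearMap.toContinuousLinearMap (entryLinearMap ℝ ℝ i j)).differentiable
  simp only [mip, trace, diag, mul_apply, transpose_apply]
  fun_prop

lemma fderiv_penalized_apply_self {n m k : ℕ} (C A₀ : Matrix (Fin n) (Fin n) ℝ)
    (A : Fin m → Matrix (Fin n) (Fin n) ℝ) (b : Fin m → ℝ) (b₀ μ : ℝ)
    (U : Matrix (Fin n) (Fin k) ℝ) :
    fderiv ℝ (fun W : Matrix (Fin n) (Fin k) ℝ =>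
        mip C (W * Wᵀ) + μ * ((mip A₀ (W * Wᵀ) - b₀) ^ 2 +
          ∑ i, (mip (A i) (W * Wᵀ) - b i) ^ 2)) U U =
      2 * mip C (U * Uᵀ) + 4 * μ * ((mip A₀ (U * Uᵀ) - b₀) * mip A₀ (U * Uᵀ) +
        ∑ i, (mip (A i) (U * Uᵀ) - b i) * mip (A i) (U * Uᵀ)) := by
  set f := fun W : Matrix (Fin n) (Fin k) ℝ =>
    mip C (W * Wᵀ) + μ * ((mip A₀ (W * Wᵀ) - b₀) ^ 2 +
      ∑ i, (mip (A i) (W * Wᵀ) - b i) ^ 2) with hf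
  have hdiff : Differentiable ℝ f := by
    have h := @differentiable_mip_mul_transpose n k
    exact (h C).add (((((h A₀).sub_const b₀).pow 2).add
      (Differentiable.fun_sum fun i _ => ((h (A i)).sub_const (b i)).pow 2)).const_mul μ)
  have hline : HasDerivAt (fun s : ℝ => s • U) U 1 := by
    have h := (hasDerivAt_id (1 : ℝ)).smul_const U
    rw [one_smul] at h
    exact h
  have hchain : HasDerivAt (fun s : ℝ => f (s • U)) (fderiv ℝ f U U) 1 :=
    (hdiff U).hasFDerivAt.comp_hasDerivAt_of_eq 1 hline (one_smul ℝ U).symm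
  have hscale : ∀ (B : Matrix (Fin n) (Fin n) ℝ) (s : ℝ),
      mip B ((s • U) * (s • U)ᵀ) = s ^ 2 * mip B (U * Uᵀ) := fun B s => by
    rw [transpose_smul, Matrix.smul_mul, Matrix.mul_smul, smul_smul, mip_smul_right, sq]
  have hsq : ∀ c : ℝ, HasDerivAt (fun s : ℝ => s ^ 2 * c) (2 * c) 1 := fun c => by
    simpa using (hasDerivAt_pow 2 (1 : ℝ)).mul_const c
  have hres : ∀ c d : ℝ, HasDerivAt (fun s : ℝ => (s ^ 2 * c - d) ^ 2) (4 * ((c - d) * c)) 1 :=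
    fun c d => by
      have h := ((hsq c).sub_const d).fun_pow 2
      rwa [show ((2 : ℕ) : ℝ) * (1 ^ 2 * c - d) ^ (2 - 1) * (2 * c) = 4 * ((c - d) * c) by
        push_cast; ring] at h
  simp only [hf, hscale] at hchain
  have hexpl := (hsq (mip C (U * Uᵀ))).add (((hres (mip A₀ (U * Uᵀ)) b₀).add
    (HasDerivAt.fun_sum (u := Finset.univ)
      fun i _ => hres (mip (A i) (U * Uᵀ)) (b i))).const_mul μ)
  rw [← hf] at hchain
  rw [hchain.unique hexpl, ← Finset.mul_sum]
  ring

lemma le_of_quadratic_le {x P c l : ℝ} (hl : 0 < l) (hP : 0 ≤ P) (hc : 0 ≤ c)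
    (h : l ^ 2 * x ^ 2 ≤ P * x + c ^ 2 / 4) : x ≤ 1 / l ^ 2 * P + c / (2 * l) := by
  by_contra! hx
  set β := c / (2 * l) with hβ
  have hcβ : c = 2 * l * β := by rw [hβ]; field_simp
  have hβ0 : 0 ≤ β := by positivity
  set q := 1 / l ^ 2 * P with hq
  have hPq : P = l ^ 2 * q := by rw [hq]; field_simp
  have hq0 : 0 ≤ q := by positivity
  rw [hcβ, hPq] at h
  have h' : x ^ 2 ≤ q * x + β ^ 2 := by
    have : l ^ 2 * x ^ 2 ≤ l ^ 2 * (q * x + β ^ 2) := by linarith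
    exact le_of_mul_le_mul_left this (by positivity)
  nlinarith

lemma neg_sq_norm_le_sum {m : ℕ} (a b : Fin m → ℝ) :
    -(vnorm b ^ 2 / 4) ≤ ∑ i, (a i - b i) * a i := by
  rw [vnorm_sq, Finset.sum_div, ← Finset.sum_neg_distrib]
  gcongr with i
  nlinarith [sq_nonneg (a i - b i / 2)]

/-- Residue and norm bounds for the compact formulation: with a
redundant constraint `⟨A₀, X⟩ = b₀`, `A₀ ≻ 0`, for every `U`:
`‖r(U)‖₂ ≤ ‖𝒜‖‖U‖_F² + ‖b‖₂` and `‖r̃(U)‖₂ ≤ ‖𝒜̃‖‖U‖_F² + ‖b̃‖₂`; and every `ε`-FOSP of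
`L̃_μ` (with `b₀ > 0`) has
`‖U‖_F² ≤ max{(ε/(2μb₀λ_max(A₀)))², (1/λ_min(A₀)²)(‖C‖₂/(2μ) + (3/2)b₀λ_max(A₀))
  + ‖b‖₂/(2λ_min(A₀))}`. -/
theorem residues_bounded_compact {n m k : ℕ}
    (C A₀ : Matrix (Fin n) (Fin n) ℝ) (hC : C.IsSymm) (hA₀ : A₀.PosDef)
    (A : Fin m → Matrix (Fin n) (Fin n) ℝ) (hA : ∀ i, (A i).IsSymm)
    (b : Fin m → ℝ) (b₀ : ℝ) (hb₀ : 0 ≤ b₀) (μ : ℝ) (hμ : 0 < μ) :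
    (∀ U : Matrix (Fin n) (Fin k) ℝ,
      vnorm (fun i => mip (A i) (U * Uᵀ) - b i) ≤ opA A * fnorm U ^ 2 + vnorm b ∧
      Real.sqrt ((mip A₀ (U * Uᵀ) - b₀) ^ 2 + ∑ i, (mip (A i) (U * Uᵀ) - b i) ^ 2) ≤
        sSup {t | ∃ Y : Matrix (Fin n) (Fin n) ℝ, Y.IsSymm ∧ fnorm Y ≤ 1 ∧
            t = Real.sqrt ((mip A₀ Y) ^ 2 + ∑ i, (mip (A i) Y) ^ 2)} * fnorm U ^ 2 +
          Real.sqrt (b₀ ^ 2 + ∑ i, (b i) ^ 2)) ∧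
    (∀ (ε : ℝ), 0 < ε → 0 < b₀ →
      ∀ U : Matrix (Fin n) (Fin k) ℝ,
        (∃ g : Matrix (Fin n) (Fin k) ℝ,
          (∀ V, fderiv ℝ (fun W : Matrix (Fin n) (Fin k) ℝ =>
            mip C (W * Wᵀ) + μ * ((mip A₀ (W * Wᵀ) - b₀) ^ 2 +
              ∑ i, (mip (A i) (W * Wᵀ) - b i) ^ 2)) U V = mipr g V) ∧
          fnorm g ≤ ε) →
        fnorm U ^ 2 ≤ max ((ε / (2 * μ * b₀ * lamMax A₀)) ^ 2)
          (1 / lamMin A₀ ^ 2 * (specNorm C / (2 * μ) + 3 / 2 * b₀ * lamMax A₀) +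
            vnorm b / (2 * lamMin A₀))) := by
  refine ⟨fun U => ⟨vnorm_residue_le A b U, ?_⟩, ?_⟩
  · simpa [vnorm, opA, Fin.sum_univ_succ] using
      vnorm_residue_le (Fin.cons A₀ A : Fin (m + 1) → _) (Fin.cons b₀ b : Fin (m + 1) → ℝ) U
  rintro ε - hb₀ U ⟨g, hg, hgε⟩
  rcases Nat.eq_zero_or_pos n with rfl | hn
  · exact le_max_of_le_left (by simpa [fnorm] using sq_nonneg _)
  have hl := lamMin_pos hn hA₀
  have hL := lamMax_pos hn hA₀
  by_cases hs : fnorm U ≤ ε / (2 * μ * b₀ * lamMax A₀)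
  · exact le_max_of_le_left (pow_le_pow_left₀ (fnorm_nonneg U) hs 2)
  refine le_max_of_le_right ?_
  rw [not_le, div_lt_iff₀ (by positivity)] at hs
  have hspec := specNorm_nonneg C
  refine le_of_quadratic_le hl (by positivity) (vnorm_nonneg b) ?_
  have hgrad := (hg U).symm.trans (fderiv_penalized_apply_self C A₀ A b b₀ μ U)
  have hgU : mipr g U ≤ ε * fnorm U := (le_abs_self _).trans ((abs_mipr_le g U).trans
    (mul_le_mul_of_nonneg_right hgε (fnorm_nonneg U)))
  have hεU : ε * fnorm U ≤ 2 * μ * b₀ * lamMax A₀ * fnorm U ^ 2 := by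
    nlinarith [fnorm_nonneg U]
  have hCU := (abs_le.1 (abs_mip_mul_transpose_le_specNorm C U)).1
  have hsum := neg_sq_norm_le_sum (fun i => mip (A i) (U * Uᵀ)) b
  have hmin := lamMin_le_mip_mul_transpose A₀ U
  have hmax := mip_mul_transpose_le_lamMax A₀ U
  set t := mip A₀ (U * Uᵀ)
  set x := fnorm U ^ 2
  have hx : 0 ≤ x := sq_nonneg _
  have hsq : lamMin A₀ ^ 2 * x ^ 2 ≤ t ^ 2 := by
    rw [← mul_pow]
    exact pow_le_pow_left₀ (by positivity) hmin 2
  have hbt : b₀ * t ≤ b₀ * (lamMax A₀ * x) := mul_le_mul_of_nonneg_left hmax hb₀.le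
  have hscaled : 4 * μ * (lamMin A₀ ^ 2 * x ^ 2 - b₀ * (lamMax A₀ * x) - vnorm b ^ 2 / 4) ≤
      2 * μ * b₀ * lamMax A₀ * x + 2 * (specNorm C * x) := by
    have : 4 * μ * (lamMin A₀ ^ 2 * x ^ 2 - b₀ * (lamMax A₀ * x) - vnorm b ^ 2 / 4) ≤
        4 * μ * ((t - b₀) * t + ∑ i, (mip (A i) (U * Uᵀ) - b i) * mip (A i) (U * Uᵀ)) := by
      gcongr
      linarith
    linarith
  have hP : 4 * μ * ((specNorm C / (2 * μ) + 3 / 2 * b₀ * lamMax A₀) * x) =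
      2 * (specNorm C * x) + 6 * μ * b₀ * lamMax A₀ * x := by
    field_simp
    ring
  refine le_of_mul_le_mul_left (a := 4 * μ) ?_ (by positivity)
  linarith
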